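/- Let n = 2^m - 1 be odd and let 2 ≤ i ≤ (n-1)/2. Then 2·C((n-1)/2, i)·C(n, 2i) - C((n-1)/2, i-1)·C(n, 2i+1) + C((n-1)/2, i)·C(n, 2i-1) > 0. In fact, already 2·C((n-1)/2, i)·C(n, 2i) - C((n-1)/2, i-1)·C(n, 2i+1) > 0. -/

import Mathlib

/-- For `1 ≤ i ≤ a`, `C(a,i-1)·C(2a+1,2i+1) < 2·C(a,i)·C(2a+1,2i)`. -/
theorem choose_pred_mul_choose_lt_two_mul (a i : ℕ) (hi : 1 ≤ i) (hia : i ≤ a) :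
    a.choose (i - 1) * (2 * a + 1).choose (2 * i + 1) <
      2 * a.choose i * (2 * a + 1).choose (2 * i) := by
  obtain ⟨k, rfl⟩ := Nat.exists_eq_add_of_le' hi
  obtain ⟨d, rfl⟩ := Nat.exists_eq_add_of_le hia
  have hB := Nat.choose_succ_right_eq (k + 1 + d) k
  have hQ := Nat.choose_succ_right_eq (2 * (k + 1 + d) + 1) (2 * (k + 1))
  rw [show k + 1 + d - k = d + 1 by omega] at hB
  rw [show 2 * (k + 1 + d) + 1 - 2 * (k + 1) = 2 * d + 1 by omega] at hQ
  rw [Nat.add_sub_cancel]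
  have hA : 0 < (k + 1 + d).choose k := Nat.choose_pos (by omega)
  have hP : 0 < (2 * (k + 1 + d) + 1).choose (2 * (k + 1)) := Nat.choose_pos (by omega)
  generalize (k + 1 + d).choose k = A at *
  generalize (k + 1 + d).choose (k + 1) = B at *
  generalize (2 * (k + 1 + d) + 1).choose (2 * (k + 1)) = P at *
  generalize (2 * (k + 1 + d) + 1).choose (2 * (k + 1) + 1) = Q at *
  refine lt_of_mul_lt_mul_right (a := (k + 1) * (2 * (k + 1) + 1)) ?_ (Nat.zero_le _)
  calc A * Q * ((k + 1) * (2 * (k + 1) + 1))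
      = A * (k + 1) * (Q * (2 * (k + 1) + 1)) := by ring
    _ = A * P * ((k + 1) * (2 * d + 1)) := by rw [hQ]; ring
    _ < A * P * (2 * (d + 1) * (2 * (k + 1) + 1)) :=
        Nat.mul_lt_mul_of_pos_left (by nlinarith) (Nat.mul_pos hA hP)
    _ = 2 * (A * (d + 1)) * P * (2 * (k + 1) + 1) := by ring
    _ = 2 * B * P * ((k + 1) * (2 * (k + 1) + 1)) := by rw [← hB]; ring

/-- For odd `n = 2^m - 1` and `2 ≤ i ≤ (n-1)/2`:
`2·C((n-1)/2,i)·C(n,2i) - C((n-1)/2,i-1)·C(n,2i+1) + C((n-1)/2,i)·C(n,2i-1) > 0`,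
and in fact already
`2·C((n-1)/2,i)·C(n,2i) - C((n-1)/2,i-1)·C(n,2i+1) > 0`. -/
theorem hamming_cross_term_positive (m i : ℕ) (hm : 1 ≤ m) (hi : 2 ≤ i)
    (hin : i ≤ (2 ^ m - 1 - 1) / 2) :
    let n : ℕ := 2 ^ m - 1
    (0 < 2 * (((n - 1) / 2).choose i : ℤ) * (n.choose (2 * i) : ℤ)
        - (((n - 1) / 2).choose (i - 1) : ℤ) * (n.choose (2 * i + 1) : ℤ)
        + (((n - 1) / 2).choose i : ℤ) * (n.choose (2 * i - 1) : ℤ)) ∧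
    (0 < 2 * (((n - 1) / 2).choose i : ℤ) * (n.choose (2 * i) : ℤ)
        - (((n - 1) / 2).choose (i - 1) : ℤ) * (n.choose (2 * i + 1) : ℤ)) := by
  intro n
  have hn : n = 2 * ((n - 1) / 2) + 1 := by
    obtain ⟨k, rfl⟩ := Nat.exists_eq_add_of_le' hm
    have := Nat.one_le_two_pow (n := k)
    simp only [n, pow_succ]
    omega
  have key := choose_pred_mul_choose_lt_two_mul ((n - 1) / 2) i (by omega) hin
  rw [← hn] at key
  zify at key
  have hC : (0 : ℤ) ≤ (((n - 1) / 2).choose i : ℤ) * (n.choose (2 * i - 1) : ℤ) := by positivity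
  constructor <;> linarith
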